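/- arXiv:1606.02766 — 2 statements merged into one kernel-verified Lean document; each statement's English description precedes it below -/
import Mathlib

section
/- Let the cone 𝒞 = 𝒞(−1, 1, n_init, C₀) be defined as below with a = −1, b = 1, integer n_init ≥ 5, and C₀ ≥ 1, and set 𝔥 = 6/(n_init − 1). Let c, δ be reals with δ > 0, −1 ≤ c−2δ, c+2δ ≤ 1, and let f₁ be the hump function defined below. If δ ≥ 2𝔥, then f₁ ∈ 𝒞, for every choice of C₀ ≥ 1. -/
open Set MeasureTheory

/-- `‖f''‖_{[α,β]} := sup_{α ≤ η < ζ ≤ β} |f'(ζ) − f'(η)|/(ζ − η)`,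
defined via the derivative `f'`. -/
noncomputable def nSup (f' : ℝ → ℝ) (α β : ℝ) : ℝ :=
  sSup {q : ℝ | ∃ η ζ, α ≤ η ∧ η < ζ ∧ ζ ≤ β ∧ q = |f' ζ - f' η| / (ζ - η)}

/-- `‖f''‖_{−∞,[α,β]} := inf_{α ≤ η < ζ ≤ β} |f'(ζ) − f'(η)|/(ζ − η)`,
defined via the derivative `f'`. -/
noncomputable def nInf (f' : ℝ → ℝ) (α β : ℝ) : ℝ :=
  sInf {q : ℝ | ∃ η ζ, α ≤ η ∧ η < ζ ∧ ζ ≤ β ∧ q = |f' ζ - f' η| / (ζ - η)}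

/-- `𝔥 := 3(b−a)/(n_init − 1)`. -/
noncomputable def littleh (a b : ℝ) (nInit : ℕ) : ℝ := 3 * (b - a) / ((nInit : ℝ) - 1)

/-- `С(h) := C₀𝔥/(𝔥 − h)`. -/
noncomputable def Cfun (a b : ℝ) (nInit : ℕ) (C₀ h : ℝ) : ℝ :=
  C₀ * littleh a b nInit / (littleh a b nInit - h)

/-- The bound `B(f,α,β,h₋,h₊)` from the definition of the cone `𝒞`. -/
noncomputable def Bfun (a b : ℝ) (nInit : ℕ) (C₀ : ℝ) (f' : ℝ → ℝ) (α β hm hp : ℝ) : ℝ :=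
  if a ≤ β - hm then
    if α + hp ≤ b then
      max (Cfun a b nInit C₀ hm * nInf f' (β - hm) α)
        (Cfun a b nInit C₀ hp * nInf f' β (α + hp))
    else Cfun a b nInit C₀ hm * nInf f' (β - hm) α
  else Cfun a b nInit C₀ hp * nInf f' β (α + hp)

/-- Membership of `f` (with derivative `f'`) in the cone `𝒞(a,b,n_init,C₀)`:
`f ∈ W^{2,∞}[a,b]` (differentiable on `[a,b]` with Lipschitz derivative) and
`‖f''‖_{[α,β]} ≤ B(f,α,β,h₋,h₊)` for all admissible `α, β, h₋, h₊`. -/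
def ConeWith (a b : ℝ) (nInit : ℕ) (C₀ : ℝ) (f f' : ℝ → ℝ) : Prop :=
  (∀ x ∈ Set.Icc a b, HasDerivWithinAt f (f' x) (Set.Icc a b) x) ∧
  (∃ K : ℝ, ∀ η ζ, a ≤ η → η < ζ → ζ ≤ b → |f' ζ - f' η| ≤ K * (ζ - η)) ∧
  ∀ α β hm hp, a ≤ α → α < β → β ≤ b →
    β - α < hm → hm < littleh a b nInit → β - α < hp → hp < littleh a b nInit →
    (a ≤ β - hm ∨ α + hp ≤ b) →
    nSup f' α β ≤ Bfun a b nInit C₀ f' α β hm hp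

/-- `f ∈ 𝒞(a,b,n_init,C₀)`. -/
def InCone (a b : ℝ) (nInit : ℕ) (C₀ : ℝ) (f : ℝ → ℝ) : Prop :=
  ∃ f' : ℝ → ℝ, ConeWith a b nInit C₀ f f'

/-- The hump function `f₁` on `[−1,1]` with parameters `c` and `δ`. -/
noncomputable def hump (c δ : ℝ) (x : ℝ) : ℝ :=
  if |x - c| ≤ 2 * δ then
    (1 / (2 * δ ^ 2)) *
      (4 * δ ^ 2 + (x - c) ^ 2 + (x - c - δ) * |x - c - δ| - (x - c + δ) * |x - c + δ|)
  else 0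

/-- The derivative of `hump c δ`, multiplied by `δ ^ 2`, as a function of `t = x - c`. -/
noncomputable def humpSlope (δ t : ℝ) : ℝ :=
  (|t + 2 * δ| - 2 * |t + δ| + 2 * |t - δ| - |t - 2 * δ|) / 2

lemma humpSlope_cases {δ : ℝ} (hδ : 0 < δ) (t : ℝ) :
    (t ≤ -2 * δ ∧ humpSlope δ t = 0) ∨
    (-2 * δ ≤ t ∧ t ≤ -δ ∧ humpSlope δ t = t + 2 * δ) ∨
    (-δ ≤ t ∧ t ≤ δ ∧ humpSlope δ t = -t) ∨
    (δ ≤ t ∧ t ≤ 2 * δ ∧ humpSlope δ t = t - 2 * δ) ∨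
    (2 * δ ≤ t ∧ humpSlope δ t = 0) := by
  unfold humpSlope
  rcases abs_cases (t + 2 * δ) with h1 | h1 <;> rcases abs_cases (t + δ) with h2 | h2 <;>
  rcases abs_cases (t - δ) with h3 | h3 <;> rcases abs_cases (t - 2 * δ) with h4 | h4 <;>
  first
  | (exfalso; linarith)
  | (left; constructor <;> linarith)
  | (right; left; refine ⟨?_, ?_, ?_⟩ <;> linarith)
  | (right; right; left; refine ⟨?_, ?_, ?_⟩ <;> linarith)
  | (right; right; right; left; refine ⟨?_, ?_, ?_⟩ <;> linarith)
  | (right; right; right; right; constructor <;> linarith)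

lemma abs_humpSlope_sub_le {δ : ℝ} (hδ : 0 < δ) {s t : ℝ} (hst : s < t) :
    |humpSlope δ t - humpSlope δ s| ≤ t - s := by
  rw [abs_le]
  rcases humpSlope_cases hδ s with h | h | h | h | h <;>
  rcases humpSlope_cases hδ t with k | k | k | k | k <;>
  constructor <;> linarith

lemma humpSlope_eq_zero_of_le {δ : ℝ} (hδ : 0 < δ) {t : ℝ} (ht : t ≤ -2 * δ) :
    humpSlope δ t = 0 := by
  rcases humpSlope_cases hδ t with k | k | k | k | k <;> linarith

lemma humpSlope_eq_zero_of_ge {δ : ℝ} (hδ : 0 < δ) {t : ℝ} (ht : 2 * δ ≤ t) :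
    humpSlope δ t = 0 := by
  rcases humpSlope_cases hδ t with k | k | k | k | k <;> linarith

/-- `[p, q]` lies in one of the three intervals on which `hump c δ` is a nonconstant quadratic. -/
def InHumpPiece (c δ p q : ℝ) : Prop :=
  (c - 2 * δ ≤ p ∧ q ≤ c - δ) ∨ (c - δ ≤ p ∧ q ≤ c + δ) ∨ (c + δ ≤ p ∧ q ≤ c + 2 * δ)

lemma InHumpPiece.le_abs_humpSlope_sub {c δ p q s t : ℝ} (hδ : 0 < δ) (h : InHumpPiece c δ p q)
    (hs : p ≤ s) (hst : s < t) (ht : t ≤ q) :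
    t - s ≤ |humpSlope δ (t - c) - humpSlope δ (s - c)| := by
  rcases h with h | h | h
  · refine le_trans ?_ (le_abs_self _)
    rcases humpSlope_cases hδ (s - c) with h | h | h | h | h <;>
    rcases humpSlope_cases hδ (t - c) with k | k | k | k | k <;> linarith
  · refine le_trans ?_ (neg_le_abs _)
    rcases humpSlope_cases hδ (s - c) with h | h | h | h | h <;>
    rcases humpSlope_cases hδ (t - c) with k | k | k | k | k <;> linarith
  · refine le_trans ?_ (le_abs_self _)
    rcases humpSlope_cases hδ (s - c) with h | h | h | h | h <;>
    rcases humpSlope_cases hδ (t - c) with k | k | k | k | k <;> linarith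

lemma hasDerivAt_mul_abs_self (x : ℝ) : HasDerivAt (fun y : ℝ => y * |y|) (2 * |x|) x := by
  rcases eq_or_ne x 0 with rfl | hx
  · rw [hasDerivAt_iff_tendsto_slope]
    have h : Filter.Tendsto (fun y : ℝ => |y|) (nhdsWithin 0 {0}ᶜ) (nhds (2 * |(0 : ℝ)|)) := by
      have := (continuous_abs (G := ℝ)).tendsto 0
      simp only [abs_zero, mul_zero] at this ⊢
      exact this.mono_left nhdsWithin_le_nhds
    refine h.congr' ?_
    filter_upwards [self_mem_nhdsWithin] with y hy
    have hy' : y ≠ 0 := hy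
    simp [slope_def_field, hy']
  · have h := (hasDerivAt_id x).mul (hasDerivAt_abs hx)
    refine h.congr_deriv ?_
    rcases lt_or_gt_of_ne hx with h | h
    · simp [h, abs_of_neg]; ring
    · simp [h, abs_of_pos]; ring

lemma hump_eq {c δ : ℝ} (hδ : 0 < δ) (x : ℝ) :
    hump c δ x = (1 / (4 * δ ^ 2)) *
      ((x - c + 2 * δ) * |x - c + 2 * δ| - 2 * ((x - c + δ) * |x - c + δ|)
        + 2 * ((x - c - δ) * |x - c - δ|) - (x - c - 2 * δ) * |x - c - 2 * δ|) := by
  unfold hump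
  split_ifs with h
  · rw [abs_le] at h
    rw [abs_of_nonneg (by linarith : 0 ≤ x - c + 2 * δ),
      abs_of_nonpos (by linarith : x - c - 2 * δ ≤ 0)]
    field_simp
    ring
  · rw [not_le, lt_abs] at h
    rcases h with h | h
    · rw [abs_of_nonneg (by linarith : 0 ≤ x - c + 2 * δ),
        abs_of_nonneg (by linarith : 0 ≤ x - c + δ), abs_of_nonneg (by linarith : 0 ≤ x - c - δ),
        abs_of_nonneg (by linarith : 0 ≤ x - c - 2 * δ)]
      ring
    · rw [abs_of_nonpos (by linarith : x - c + 2 * δ ≤ 0),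
        abs_of_nonpos (by linarith : x - c + δ ≤ 0), abs_of_nonpos (by linarith : x - c - δ ≤ 0),
        abs_of_nonpos (by linarith : x - c - 2 * δ ≤ 0)]
      ring

lemma hasDerivAt_hump {c δ : ℝ} (hδ : 0 < δ) (x : ℝ) :
    HasDerivAt (hump c δ) (1 / δ ^ 2 * humpSlope δ (x - c)) x := by
  have key (k : ℝ) :
      HasDerivAt (fun y : ℝ => (y - c + k) * |y - c + k|) (2 * |x - c + k|) x := by
    have h1 : HasDerivAt (fun y : ℝ => y - c + k) 1 x :=
      ((hasDerivAt_id x).sub_const c).add_const k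
    exact ((hasDerivAt_mul_abs_self (x - c + k)).comp x h1).congr_deriv (mul_one _)
  have h := ((((key (2 * δ)).sub ((key δ).const_mul 2)).add ((key (-δ)).const_mul 2)).sub
    (key (-(2 * δ)))).const_mul (1 / (4 * δ ^ 2))
  have e : hump c δ = _ := funext (hump_eq (c := c) hδ)
  rw [e]
  simp only [← sub_eq_add_neg] at h
  refine h.congr_deriv ?_
  unfold humpSlope
  field_simp
  ring

lemma nSup_le {g : ℝ → ℝ} {α β M : ℝ} (hM : 0 ≤ M)
    (h : ∀ s t, α ≤ s → s < t → t ≤ β → |g t - g s| ≤ M * (t - s)) : nSup g α β ≤ M := by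
  refine Real.sSup_le ?_ hM
  rintro q ⟨s, t, hs, hst, ht, rfl⟩
  rw [div_le_iff₀ (sub_pos.2 hst)]
  exact h s t hs hst ht

lemma le_nInf {g : ℝ → ℝ} {α β M : ℝ} (hαβ : α < β)
    (h : ∀ s t, α ≤ s → s < t → t ≤ β → M * (t - s) ≤ |g t - g s|) : M ≤ nInf g α β := by
  refine le_csInf ⟨_, α, β, le_rfl, hαβ, le_rfl, rfl⟩ ?_
  rintro q ⟨s, t, hs, hst, ht, rfl⟩
  rw [le_div_iff₀ (sub_pos.2 hst)]
  exact h s t hs hst ht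

lemma nInf_nonneg (g : ℝ → ℝ) (α β : ℝ) : 0 ≤ nInf g α β := by
  refine Real.sInf_nonneg ?_
  rintro q ⟨s, t, hs, hst, ht, rfl⟩
  exact div_nonneg (abs_nonneg _) (sub_pos.2 hst).le

lemma one_le_Cfun {a b C₀ h : ℝ} {nInit : ℕ} (hC : 1 ≤ C₀) (h0 : 0 < h)
    (hh : h < littleh a b nInit) : 1 ≤ Cfun a b nInit C₀ h := by
  unfold Cfun
  rw [le_div_iff₀ (sub_pos.2 hh)]
  nlinarith

lemma Bfun_nonneg {a b C₀ α β hm hp : ℝ} {nInit : ℕ} (g : ℝ → ℝ)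
    (h1 : 0 ≤ Cfun a b nInit C₀ hm) (h2 : 0 ≤ Cfun a b nInit C₀ hp) :
    0 ≤ Bfun a b nInit C₀ g α β hm hp := by
  unfold Bfun
  split_ifs
  · exact le_max_of_le_left (mul_nonneg h1 (nInf_nonneg _ _ _))
  · exact mul_nonneg h1 (nInf_nonneg _ _ _)
  · exact mul_nonneg h2 (nInf_nonneg _ _ _)

/-- An interval `[p, q]` of length less than `δ` contains at most one breakpoint of the hump. -/
lemma inHumpPiece_left_or_right {c δ p α β q : ℝ} (hpα : p < α) (hαβ : α < β) (hβq : β < q)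
    (hpq : q - p < δ) (h1 : c - 2 * δ < β) (h2 : α < c + 2 * δ) :
    InHumpPiece c δ p α ∨ InHumpPiece c δ β q := by
  unfold InHumpPiece
  grind

/-- If the hump is wide enough, `δ ≥ 2𝔥`, then `f₁ ∈ 𝒞(−1,1,n_init,C₀)`
for every choice of `C₀ ≥ 1`. -/
theorem stmt10 (nInit : ℕ) (hn : 5 ≤ nInit) (C₀ : ℝ) (hC : 1 ≤ C₀)
    (c δ : ℝ) (hδ : 0 < δ) (hl : -1 ≤ c - 2 * δ) (hr : c + 2 * δ ≤ 1)
    (hwide : 2 * littleh (-1) 1 nInit ≤ δ) :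
    InCone (-1) 1 nInit C₀ (hump c δ) := by
  have hM : 0 < 1 / δ ^ 2 := by positivity
  have lip (s t : ℝ) (hst : s < t) :
      |1 / δ ^ 2 * humpSlope δ (t - c) - 1 / δ ^ 2 * humpSlope δ (s - c)|
        ≤ 1 / δ ^ 2 * (t - s) := by
    rw [← mul_sub, abs_mul, abs_of_pos hM]
    have := abs_humpSlope_sub_le hδ (sub_lt_sub_right hst c)
    exact mul_le_mul_of_nonneg_left (by linarith) hM.le
  refine ⟨fun x => 1 / δ ^ 2 * humpSlope δ (x - c),
    fun x _ => (hasDerivAt_hump hδ x).hasDerivWithinAt,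
    ⟨1 / δ ^ 2, fun s t _ hst _ => lip s t hst⟩, ?_⟩
  intro α β hm hp hα hαβ hβ hm1 hm2 hp1 hp2 hside
  set g : ℝ → ℝ := fun x => 1 / δ ^ 2 * humpSlope δ (x - c) with hg
  have hCm := one_le_Cfun hC (by linarith) hm2
  have hCp := one_le_Cfun hC (by linarith) hp2
  have hB : 0 ≤ Bfun (-1) 1 nInit C₀ g α β hm hp := Bfun_nonneg g (by linarith) (by linarith)
  rcases le_or_gt β (c - 2 * δ) with hz | hz
  · refine (nSup_le le_rfl fun s t hs hst ht => ?_).trans hB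
    simp [hg, humpSlope_eq_zero_of_le hδ (show s - c ≤ -2 * δ by linarith),
      humpSlope_eq_zero_of_le hδ (show t - c ≤ -2 * δ by linarith)]
  rcases le_or_gt (c + 2 * δ) α with hz' | hz'
  · refine (nSup_le le_rfl fun s t hs hst ht => ?_).trans hB
    simp [hg, humpSlope_eq_zero_of_ge hδ (show 2 * δ ≤ s - c by linarith),
      humpSlope_eq_zero_of_ge hδ (show 2 * δ ≤ t - c by linarith)]
  refine (nSup_le hM.le fun s t _ hst _ => lip s t hst).trans ?_
  have piece {p q C : ℝ} (hC1 : 1 ≤ C) (hpq : p < q) (h : InHumpPiece c δ p q) :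
      1 / δ ^ 2 ≤ C * nInf g p q := by
    have h1 : 1 / δ ^ 2 ≤ nInf g p q := by
      refine le_nInf hpq fun s t hs hst ht => ?_
      rw [hg, ← mul_sub, abs_mul, abs_of_pos hM]
      exact mul_le_mul_of_nonneg_left (h.le_abs_humpSlope_sub hδ hs hst ht) hM.le
    exact h1.trans (le_mul_of_one_le_left (nInf_nonneg _ _ _) hC1)
  have hpl : β - hm < α := by linarith
  have hpr : β < α + hp := by linarith
  unfold Bfun
  split_ifs with ha hb
  · rcases inHumpPiece_left_or_right (c := c) (δ := δ) hpl hαβ hpr (by linarith) hz hz' with h | h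
    · exact le_max_of_le_left (piece hCm hpl h)
    · exact le_max_of_le_right (piece hCp hpr h)
  · exact piece hCm hpl (Or.inr (Or.inr ⟨by linarith, by linarith⟩))
  · exact piece hCp hpr (Or.inl ⟨by linarith, by linarith⟩)
end

section
/- (Fooling-function lemma underlying the lower complexity bounds on the cone 𝒞.) Let a < b, let n_init ≥ 5 be an integer, let C₀ > 1, and let 𝒞 = 𝒞(a,b,n_init,C₀) be the cone defined below. Let n ∈ ℕ, let x₁, …, xₙ be any points in [a,b], and let γ > 0. Then there exist functions f₊ and f₋, both belonging to 𝒞, such that f₊(xᵢ) = f₋(xᵢ) for all i = 1,…,n, ‖f₊''‖_{[a,b]} = ‖f₋''‖_{[a,b]} = 2C₀γ/(C₀+1), and sup_{x∈[a,b]} |f₊(x) − f₋(x)| ≥ γ·(C₀−1)·(b−a)²/(8·(C₀+1)·(n+1)²). -/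
open Set MeasureTheory

/-- A bound from above on all difference quotients bounds `nSup`. -/
lemma nSup_le_of_forall {f' : ℝ → ℝ} {α β M : ℝ} (hM : 0 ≤ M)
    (h : ∀ η ζ, α ≤ η → η < ζ → ζ ≤ β → |f' ζ - f' η| ≤ M * (ζ - η)) :
    nSup f' α β ≤ M := by
  refine Real.sSup_le ?_ hM
  rintro q ⟨η, ζ, h1, h2, h3, rfl⟩
  rw [div_le_iff₀ (sub_pos.2 h2)]
  exact h η ζ h1 h2 h3

/-- An upper bound on all difference quotients that is attained equals `nSup`. -/
lemma nSup_eq_of_forall {f' : ℝ → ℝ} {α β M η₀ ζ₀ : ℝ} (hM : 0 ≤ M)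
    (h : ∀ η ζ, α ≤ η → η < ζ → ζ ≤ β → |f' ζ - f' η| ≤ M * (ζ - η))
    (hα : α ≤ η₀) (hlt : η₀ < ζ₀) (hβ : ζ₀ ≤ β) (heq : f' ζ₀ - f' η₀ = M * (ζ₀ - η₀)) :
    nSup f' α β = M := by
  refine le_antisymm (nSup_le_of_forall hM h) (le_csSup ⟨M, ?_⟩ ⟨η₀, ζ₀, hα, hlt, hβ, ?_⟩)
  · rintro q ⟨η, ζ, h1, h2, h3, rfl⟩
    rw [div_le_iff₀ (sub_pos.2 h2)]
    exact h η ζ h1 h2 h3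
  · rw [heq, abs_of_nonneg (mul_nonneg hM (sub_pos.2 hlt).le),
      mul_div_cancel_right₀ _ (sub_pos.2 hlt).ne']

/-- A bound from below on all difference quotients bounds `nInf`. -/
lemma le_nInf_of_forall {f' : ℝ → ℝ} {α β m : ℝ} (hαβ : α < β)
    (h : ∀ η ζ, α ≤ η → η < ζ → ζ ≤ β → m * (ζ - η) ≤ |f' ζ - f' η|) :
    m ≤ nInf f' α β := by
  refine le_csInf ⟨_, α, β, le_rfl, hαβ, le_rfl, rfl⟩ ?_
  rintro q ⟨η, ζ, h1, h2, h3, rfl⟩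
  rw [le_div_iff₀ (sub_pos.2 h2)]
  exact h η ζ h1 h2 h3

lemma le_Cfun {a b C₀ h : ℝ} {nInit : ℕ} (hC : 0 ≤ C₀) (h0 : 0 ≤ h)
    (hh : h < littleh a b nInit) : C₀ ≤ Cfun a b nInit C₀ h := by
  rw [Cfun, le_div_iff₀ (sub_pos.2 hh)]
  nlinarith [mul_nonneg hC h0]

/-- A function whose second-order difference quotients all lie in `[m, C₀ m]` belongs to
the cone. -/
lemma coneWith_of_bounds {a b C₀ m : ℝ} {nInit : ℕ} {f f' : ℝ → ℝ} (hC : 0 ≤ C₀) (hm : 0 ≤ m)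
    (hf : ∀ x, HasDerivAt f (f' x) x)
    (hlow : ∀ η ζ, η < ζ → m * (ζ - η) ≤ |f' ζ - f' η|)
    (hup : ∀ η ζ, η < ζ → |f' ζ - f' η| ≤ C₀ * m * (ζ - η)) :
    ConeWith a b nInit C₀ f f' := by
  refine ⟨fun x _ => (hf x).hasDerivWithinAt, ⟨C₀ * m, fun η ζ _ h _ => hup η ζ h⟩, ?_⟩
  intro α β h₁ h₂ _ hαβ _ hl₁ hu₁ hl₂ hu₂ hor
  have hs : nSup f' α β ≤ C₀ * m :=
    nSup_le_of_forall (mul_nonneg hC hm) fun η ζ _ h _ => hup η ζ h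
  have key : ∀ h u v, β - α < h → h < littleh a b nInit → u < v →
      nSup f' α β ≤ Cfun a b nInit C₀ h * nInf f' u v := fun h u v hl hu huv => by
    have hc : C₀ ≤ Cfun a b nInit C₀ h := le_Cfun hC (by linarith) hu
    exact hs.trans (mul_le_mul hc (le_nInf_of_forall huv fun η ζ _ h _ => hlow η ζ h) hm
      (hC.trans hc))
  have k₁ := key h₁ (β - h₁) α hl₁ hu₁ (by linarith)
  have k₂ := key h₂ β (α + h₂) hl₂ hu₂ (by linarith)
  unfold Bfun
  split_ifs
  exacts [le_max_of_le_left k₁, k₁, k₂]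

/-- Among `n` points, some interval of length `(b - a) / (n + 1)` has none in its interior. -/
lemma exists_gap {a b : ℝ} (hab : a < b) {n : ℕ} (x : Fin n → ℝ) :
    ∃ c, a ≤ c ∧ c + (b - a) / (n + 1) ≤ b ∧
      ∀ i, x i ≤ c ∨ c + (b - a) / (n + 1) ≤ x i := by
  set L := (b - a) / ((n : ℝ) + 1) with hL
  have hn : (0 : ℝ) < n + 1 := by positivity
  have hLpos : 0 < L := div_pos (sub_pos.2 hab) hn
  have hLn : L * (n + 1) = b - a := div_mul_cancel₀ _ hn.ne'
  by_contra! H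
  have H' : ∀ k : Fin (n + 1), ∃ i, a + k * L < x i ∧ x i < a + k * L + L := by
    intro k
    have hk : (k : ℝ) ≤ n := by exact_mod_cast Nat.lt_succ_iff.1 k.2
    refine H (a + k * L) ?_ ?_
    · have : 0 ≤ (k : ℝ) * L := by positivity
      linarith
    · nlinarith
  choose g hg₁ hg₂ using H'
  have hinj : Function.Injective g := by
    intro j k hjk
    have h₁ := hg₁ j
    have h₂ := hg₂ j
    rw [hjk] at h₁ h₂
    have h₃ := hg₁ k
    have h₄ := hg₂ k
    have hlt : ((j : ℕ) : ℝ) < ((k : ℕ) : ℝ) + 1 := by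
      by_contra! h
      nlinarith
    have hgt : ((k : ℕ) : ℝ) < ((j : ℕ) : ℝ) + 1 := by
      by_contra! h
      nlinarith
    have hlt' : (j : ℕ) < k + 1 := by exact_mod_cast hlt
    have hgt' : (k : ℕ) < j + 1 := by exact_mod_cast hgt
    exact Fin.ext (by omega)
  simpa using Fintype.card_le_of_injective g hinj

/-- The derivative of the bump function: a zigzag with slopes `0, 1, -1, 1, 0`, with nodes
`0`, `l`, `3l`, `4l`. -/
noncomputable def bumpDeriv (l u : ℝ) : ℝ :=
  max u 0 - 2 * max (u - l) 0 + 2 * max (u - 3 * l) 0 - max (u - 4 * l) 0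

/-- A `C¹` bump supported on `[0, 4l]` with second derivative in `{-1, 0, 1}`. -/
noncomputable def bump (l u : ℝ) : ℝ :=
  (max u 0 ^ 2 - 2 * max (u - l) 0 ^ 2 + 2 * max (u - 3 * l) 0 ^ 2 - max (u - 4 * l) 0 ^ 2) / 2

lemma hasDerivAt_max_zero_sq (u : ℝ) : HasDerivAt (fun u : ℝ => max u 0 ^ 2) (2 * max u 0) u := by
  rcases lt_trichotomy u 0 with h | rfl | h
  · rw [max_eq_right h.le, mul_zero]
    refine (hasDerivAt_const u (0 : ℝ)).congr_of_eventuallyEq ?_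
    filter_upwards [Iio_mem_nhds h] with v hv
    simp [max_eq_right (le_of_lt (mem_Iio.1 hv))]
  · rw [max_self, mul_zero, hasDerivAt_iff_isLittleO_nhds_zero]
    have h : (fun t : ℝ => t ^ 2) =o[nhds 0] fun t : ℝ => t := by
      simpa using Asymptotics.isLittleO_pow_pow (𝕜 := ℝ) (m := 1) (n := 2) one_lt_two
    refine Asymptotics.IsBigO.trans_isLittleO (Asymptotics.IsBigO.of_bound 1 ?_) h
    filter_upwards with t
    rcases le_total t 0 with ht | ht <;> simp [ht, sq_nonneg]
  · rw [max_eq_left h.le]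
    have h2 := hasDerivAt_pow 2 u
    norm_num at h2
    refine h2.congr_of_eventuallyEq ?_
    filter_upwards [Ioi_mem_nhds h] with v hv
    rw [max_eq_left (le_of_lt (mem_Ioi.1 hv))]

lemma hasDerivAt_bump (l u : ℝ) : HasDerivAt (bump l) (bumpDeriv l u) u := by
  have h (d : ℝ) : HasDerivAt (fun u : ℝ => max (u - d) 0 ^ 2) (2 * max (u - d) 0) u :=
    (hasDerivAt_max_zero_sq (u - d)).comp_sub_const u d
  have H := ((((hasDerivAt_max_zero_sq u).sub ((h l).const_mul 2)).add
    ((h (3 * l)).const_mul 2)).sub (h (4 * l))).div_const 2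
  refine H.congr_deriv ?_
  unfold bumpDeriv
  ring

lemma abs_bumpDeriv_sub_le {l : ℝ} (hl : 0 ≤ l) {u v : ℝ} (huv : u ≤ v) :
    |bumpDeriv l v - bumpDeriv l u| ≤ v - u := by
  unfold bumpDeriv
  rw [abs_le]
  rcases max_cases u 0 with h₁ | h₁ <;> rcases max_cases (u - l) 0 with h₂ | h₂ <;>
  rcases max_cases (u - 3 * l) 0 with h₃ | h₃ <;> rcases max_cases (u - 4 * l) 0 with h₄ | h₄ <;>
  first
  | (exfalso; linarith)
  | (rcases max_cases v 0 with h₅ | h₅ <;> rcases max_cases (v - l) 0 with h₆ | h₆ <;>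
      rcases max_cases (v - 3 * l) 0 with h₇ | h₇ <;>
      rcases max_cases (v - 4 * l) 0 with h₈ | h₈ <;> constructor <;> linarith)

lemma bump_of_nonpos {l u : ℝ} (hl : 0 ≤ l) (hu : u ≤ 0) : bump l u = 0 := by
  rw [bump, max_eq_right hu, max_eq_right (by linarith), max_eq_right (by linarith),
    max_eq_right (by linarith)]
  ring

lemma bump_of_le {l u : ℝ} (hl : 0 ≤ l) (hu : 4 * l ≤ u) : bump l u = 0 := by
  rw [bump, max_eq_left (by linarith), max_eq_left (by linarith), max_eq_left (by linarith),
    max_eq_left (by linarith)]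
  ring

lemma bump_two_mul {l : ℝ} (hl : 0 ≤ l) : bump l (2 * l) = l ^ 2 := by
  rw [bump, max_eq_left (by linarith), max_eq_left (by linarith), max_eq_right (by linarith),
    max_eq_right (by linarith)]
  ring

lemma bumpDeriv_zero {l : ℝ} (hl : 0 ≤ l) : bumpDeriv l 0 = 0 := by
  rw [bumpDeriv, max_self, max_eq_right (by linarith), max_eq_right (by linarith),
    max_eq_right (by linarith)]
  ring

lemma bumpDeriv_self {l : ℝ} (hl : 0 ≤ l) : bumpDeriv l l = l := by
  rw [bumpDeriv, max_eq_left hl, max_eq_right (by linarith), max_eq_right (by linarith),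
    max_eq_right (by linarith)]
  ring

lemma bumpDeriv_two_mul {l : ℝ} (hl : 0 ≤ l) : bumpDeriv l (2 * l) = 0 := by
  rw [bumpDeriv, max_eq_left (by linarith), max_eq_left (by linarith),
    max_eq_right (by linarith), max_eq_right (by linarith)]
  ring

/-- A parabola perturbed by a multiple of a bump: its second-order difference quotients deviate
from `γ` by at most `|ε|`. -/
lemma hasDerivAt_parabola_add_bump (γ ε c l x : ℝ) :
    HasDerivAt (fun x => γ * x ^ 2 / 2 + ε * bump l (x - c))
      (γ * x + ε * bumpDeriv l (x - c)) x := by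
  have h := (((hasDerivAt_pow 2 x).const_mul γ).div_const 2).add
    (((hasDerivAt_bump l (x - c)).comp_sub_const x c).const_mul ε)
  refine h.congr_deriv ?_
  norm_num
  ring

lemma parabola_add_bump_bounds {γ ε c l : ℝ} (hl : 0 ≤ l) (hγ : |ε| ≤ γ) {η ζ : ℝ} (h : η < ζ) :
    (γ - |ε|) * (ζ - η) ≤
        |(γ * ζ + ε * bumpDeriv l (ζ - c)) - (γ * η + ε * bumpDeriv l (η - c))| ∧
      |(γ * ζ + ε * bumpDeriv l (ζ - c)) - (γ * η + ε * bumpDeriv l (η - c))| ≤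
        (γ + |ε|) * (ζ - η) := by
  have hb := abs_bumpDeriv_sub_le hl (sub_le_sub_right h.le c)
  have he : |ε * (bumpDeriv l (ζ - c) - bumpDeriv l (η - c))| ≤ |ε| * (ζ - η) := by
    rw [abs_mul]
    refine mul_le_mul_of_nonneg_left ?_ (abs_nonneg ε)
    linarith
  have hpos : 0 ≤ (γ - |ε|) * (ζ - η) := mul_nonneg (sub_nonneg.2 hγ) (sub_pos.2 h).le
  rw [abs_le] at he
  rw [abs_of_nonneg (a := γ * ζ + _ - _) (by linarith)]
  constructor <;> linarith

/-- Fooling-function lemma for the cone `𝒞`: given any `n` data sites in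
`[a,b]` and any `γ > 0`, there are `f₊, f₋ ∈ 𝒞` agreeing at all data sites,
with `‖f₊''‖_{[a,b]} = ‖f₋''‖_{[a,b]} = 2C₀γ/(C₀+1)` and
`sup_{[a,b]} |f₊ − f₋| ≥ γ(C₀−1)(b−a)²/(8(C₀+1)(n+1)²)`. -/
theorem stmt14 (a b : ℝ) (hab : a < b) (nInit : ℕ) (hn : 5 ≤ nInit)
    (C₀ : ℝ) (hC : 1 < C₀)
    (n : ℕ) (x : Fin n → ℝ) (hx : ∀ i, x i ∈ Set.Icc a b) (γ : ℝ) (hγ : 0 < γ) :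
    ∃ fp fp' fm fm' : ℝ → ℝ,
      ConeWith a b nInit C₀ fp fp' ∧ ConeWith a b nInit C₀ fm fm' ∧
      (∀ i, fp (x i) = fm (x i)) ∧
      nSup fp' a b = 2 * C₀ * γ / (C₀ + 1) ∧
      nSup fm' a b = 2 * C₀ * γ / (C₀ + 1) ∧
      ∃ t ∈ Set.Icc a b,
        γ * (C₀ - 1) * (b - a) ^ 2 / (8 * (C₀ + 1) * ((n : ℝ) + 1) ^ 2) ≤ |fp t - fm t| := by
  obtain ⟨c, hac, hcb, hgap⟩ := exists_gap hab x
  have hn1 : (0 : ℝ) < (n : ℝ) + 1 := by positivity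
  have hC1 : 0 < C₀ + 1 := by linarith
  obtain ⟨l, hl⟩ : ∃ l, l = (b - a) / ((n : ℝ) + 1) / 4 := ⟨_, rfl⟩
  obtain ⟨δ, hδ⟩ : ∃ δ, δ = γ * (C₀ - 1) / (C₀ + 1) := ⟨_, rfl⟩
  have hl0 : 0 < l := hl ▸ div_pos (div_pos (sub_pos.2 hab) hn1) four_pos
  have h4l : (b - a) / ((n : ℝ) + 1) = 4 * l := by rw [hl]; ring
  rw [h4l] at hcb hgap
  have hδ0 : 0 < δ := hδ ▸ div_pos (mul_pos hγ (sub_pos.2 hC)) hC1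
  have hlow : γ - δ = 2 * γ / (C₀ + 1) := by rw [hδ]; field_simp; ring
  have hup : γ + δ = 2 * C₀ * γ / (C₀ + 1) := by rw [hδ]; field_simp; ring
  have hm : 0 < γ - δ := hlow ▸ by positivity
  have hmul : γ + δ = C₀ * (γ - δ) := by rw [hlow, hup]; ring
  have hbd : ∀ ε, |ε| = δ → ∀ η ζ, η < ζ → _ := fun ε hε η ζ h =>
    parabola_add_bump_bounds (γ := γ) (ε := ε) (c := c) hl0.le (by linarith) h
  have hcone : ∀ ε, |ε| = δ →
      ConeWith a b nInit C₀ (fun x => γ * x ^ 2 / 2 + ε * bump l (x - c))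
        (fun x => γ * x + ε * bumpDeriv l (x - c)) := fun ε hε =>
    coneWith_of_bounds (m := γ - δ) (by linarith) hm.le
      (hasDerivAt_parabola_add_bump γ ε c l)
      (fun η ζ h => hε ▸ (hbd ε hε η ζ h).1)
      (fun η ζ h => by simpa only [← hmul, hε] using (hbd ε hε η ζ h).2)
  have hp : |δ| = δ := abs_of_pos hδ0
  have hn' : |-δ| = δ := by rw [abs_neg, hp]
  refine ⟨_, _, _, _, hcone δ hp, hcone (-δ) hn', ?_, ?_, ?_, c + 2 * l, ?_, ?_⟩
  · intro i
    have : bump l (x i - c) = 0 := by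
      rcases hgap i with h | h
      · exact bump_of_nonpos hl0.le (by linarith)
      · exact bump_of_le hl0.le (by linarith)
    simp [this]
  · rw [← hup]
    refine nSup_eq_of_forall (η₀ := c) (ζ₀ := c + l) (by linarith)
      (fun η ζ _ h _ => by simpa only [hp] using (hbd δ hp η ζ h).2)
      hac (by linarith) (by linarith) ?_
    simp only [sub_self, add_sub_cancel_left, bumpDeriv_zero hl0.le, bumpDeriv_self hl0.le]
    ring
  · rw [← hup]
    refine nSup_eq_of_forall (η₀ := c + l) (ζ₀ := c + 2 * l) (by linarith)
      (fun η ζ _ h _ => by simpa only [hn'] using (hbd (-δ) hn' η ζ h).2)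
      (by linarith) (by linarith) (by linarith) ?_
    simp only [add_sub_cancel_left, bumpDeriv_two_mul hl0.le, bumpDeriv_self hl0.le]
    ring
  · constructor <;> linarith
  · simp only [add_sub_cancel_left, bump_two_mul hl0.le]
    have h : γ * (c + 2 * l) ^ 2 / 2 + δ * l ^ 2 - (γ * (c + 2 * l) ^ 2 / 2 + -δ * l ^ 2)
        = 2 * δ * l ^ 2 := by ring
    rw [h, abs_of_nonneg (by positivity), hδ, hl]
    apply le_of_eq
    field_simp
    ring
end
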